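/- arXiv:2603.29178 — 8 statements merged into one kernel-verified Lean document; each statement's English description precedes it below -/
import Mathlib

section
/- Let γ > 0, Ω > 0 and η be real numbers, and define the cubic polynomial p(z) = z³ + (γ − η)·z² + Ω·z + Ω·γ over ℂ. Then every complex root z of p satisfies Re z < 0 if and only if η < 0. -/
/-- If all complex roots of the monic real quadratic `z ^ 2 + b * z + c` lie in the open left
half-plane, then its linear coefficient is positive. -/
theorem linear_coeff_pos_of_quadratic_roots_re_neg (b c : ℝ)
    (h : ∀ z : ℂ, z ^ 2 + b * z + c = 0 → z.re < 0) : 0 < b := by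
  obtain ⟨w, hw⟩ := IsAlgClosed.exists_pow_nat_eq ((b : ℂ) ^ 2 - 4 * c) (n := 2) (by norm_num)
  have h₁ := h ((-b + w) / 2) (by linear_combination hw / 4)
  have h₂ := h ((-b - w) / 2) (by linear_combination hw / 4)
  simp at h₁ h₂
  linarith

/-- A real monic cubic with positive constant term `Ω * γ` has a negative real root. -/
theorem exists_neg_root_cubic (a γ Ω : ℝ) (hγ : 0 < γ) (hΩ : 0 < Ω) :
    ∃ r < 0, r ^ 3 + a * r ^ 2 + Ω * r + Ω * γ = 0 := by
  have hM : 0 ≤ γ + |a| := by positivity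
  obtain ⟨r, ⟨-, hr⟩, h⟩ := intermediate_value_Icc (neg_nonpos.mpr hM)
    (f := fun x : ℝ => x ^ 3 + a * x ^ 2 + Ω * x + Ω * γ) (by fun_prop)
    (show (0 : ℝ) ∈ _ by
      constructor
      · have h₁ : 0 ≤ (γ + |a|) ^ 2 * (γ + |a| - a) :=
          mul_nonneg (sq_nonneg _) (by linarith [le_abs_self a])
        have h₂ : 0 ≤ Ω * |a| := by positivity
        linarith
      · nlinarith [mul_pos hΩ hγ])
  refine ⟨r, lt_of_le_of_ne hr ?_, h⟩
  rintro rfl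
  dsimp only at h
  nlinarith [mul_pos hΩ hγ]

theorem routh_hurwitz_cubic (γ Ω η : ℝ) (hγ : 0 < γ) (hΩ : 0 < Ω) :
    (∀ z : ℂ, z ^ 3 + (γ - η : ℝ) * z ^ 2 + (Ω : ℝ) * z + (Ω * γ : ℝ) = 0 → z.re < 0) ↔
      η < 0 := by
  constructor
  · intro h
    obtain ⟨r, hr, hroot⟩ := exists_neg_root_cubic (γ - η) γ Ω hγ hΩ
    set b := γ - η + r with hb
    set c := Ω + r * b with hc
    have hrc : -r * c = Ω * γ := by rw [hc, hb]; linear_combination -hroot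
    have hbpos : 0 < b := by
      refine linear_coeff_pos_of_quadratic_roots_re_neg b c fun z hz => h z ?_
      have hb' : ((γ - η : ℝ) : ℂ) = b - r := by rw [hb]; push_cast; ring
      have hc' : (Ω : ℂ) = c - r * b := by rw [hc]; push_cast; ring
      rw [← hrc, hb', hc']
      push_cast
      linear_combination (z - r) * hz
    have hcpos : 0 < c := pos_of_mul_pos_right (hrc ▸ mul_pos hΩ hγ) (by linarith)
    have key : Ω * -η = b * c + b ^ 2 * -r + b * r ^ 2 := by
      have hη : -η = b - r - γ := by rw [hb]; ring
      have hΩ' : Ω = c - r * b := by rw [hc]; ring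
      rw [hη, mul_sub, ← hrc, hΩ']
      ring
    have hr' : 0 < -r := neg_pos.mpr hr
    have hpos : 0 < Ω * -η := by rw [key]; positivity
    exact neg_pos.mp (pos_of_mul_pos_right hpos hΩ.le)
  · rintro hη ⟨x, y⟩ hz
    by_contra! hx
    replace hx : 0 ≤ x := hx
    have ha : 0 < γ - η := by linarith
    generalize haη : γ - η = a at hz ha
    have hre := congrArg Complex.re hz
    have him := congrArg Complex.im hz
    simp [pow_succ] at hre him
    have hmul : y * (3 * x ^ 2 - y ^ 2 + 2 * a * x + Ω) = 0 := by linear_combination him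
    rcases mul_eq_zero.mp hmul with rfl | hy
    · have : 0 < x ^ 3 + a * x ^ 2 + Ω * x + Ω * γ := by positivity
      linarith
    · have : 0 < 8 * x ^ 3 + 8 * a * x ^ 2 + (2 * Ω + 2 * a ^ 2) * x + Ω * -η := by
        have := neg_pos.mpr hη
        positivity
      have heq : 8 * x ^ 3 + 8 * a * x ^ 2 + (2 * Ω + 2 * a ^ 2) * x + Ω * -η = 0 := by
        linear_combination -hre + (3 * x + a) * hy + Ω * haη
      linarith
end

section
/- Let γ > 0, Ω > 0 and η be real numbers, and define p(z) = z³ + (γ − η)·z² + Ω·z + Ω·γ over ℂ. If ω is a nonzero real number such that p(i·ω) = 0, then ω² = Ω and η = 0. -/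
theorem imaginary_roots_only_at_hopf (γ Ω η : ℝ) (hγ : 0 < γ) (hΩ : 0 < Ω)
    (ω : ℝ) (hω : ω ≠ 0)
    (hroot : (Complex.I * ω) ^ 3 + (γ - η : ℝ) * (Complex.I * ω) ^ 2 +
        (Ω : ℝ) * (Complex.I * ω) + (Ω * γ : ℝ) = 0) :
    ω ^ 2 = Ω ∧ η = 0 := by
  have hre := congrArg Complex.re hroot
  have him := congrArg Complex.im hroot
  simp [pow_succ] at hre him
  have hsq : ω ^ 2 = Ω := mul_right_cancel₀ hω (by linear_combination -him)
  refine ⟨hsq, ?_⟩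
  have hmul : Ω * η = 0 := by linear_combination hre + (γ - η) * hsq
  exact (mul_eq_zero.mp hmul).resolve_left hΩ.ne'
end

section
/- Let γ > 0, Ω > 0 and η ≠ 0 be real numbers, and define p(z) = z³ + (γ − η)·z² + Ω·z + Ω·γ over ℂ. Then every complex root z of p satisfies Re z ≠ 0. -/
theorem hyperbolic_away_from_hopf (γ Ω η : ℝ) (hγ : 0 < γ) (hΩ : 0 < Ω) (hη : η ≠ 0) :
    ∀ z : ℂ, z ^ 3 + (γ - η : ℝ) * z ^ 2 + (Ω : ℝ) * z + (Ω * γ : ℝ) = 0 → z.re ≠ 0 := by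
  rintro ⟨x, y⟩ h hx
  obtain rfl : x = 0 := hx
  have hre := congrArg Complex.re h
  have him := congrArg Complex.im h
  simp only [pow_succ, pow_zero, one_mul, Complex.add_re, Complex.add_im, Complex.mul_re,
    Complex.mul_im, Complex.ofReal_re, Complex.ofReal_im, Complex.zero_re, Complex.zero_im]
    at hre him
  have him' : y * (Ω - y ^ 2) = 0 := by linear_combination him
  have hre' : Ω * γ - (γ - η) * y ^ 2 = 0 := by linear_combination hre
  rcases mul_eq_zero.mp him' with hy | hy
  · rw [hy] at hre'
    exact (mul_pos hΩ hγ).ne' (by linear_combination hre')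
  · exact mul_ne_zero hη hΩ.ne' (by linear_combination hre' - (γ - η) * hy)
end

section
/- Let γ > 0 and Ω > 0 be real numbers, and for each real η define p(z;η) = z³ + (γ − η)·z² + Ω·z + Ω·γ over ℂ. Suppose ρ : ℝ → ℂ is differentiable at 0, satisfies p(ρ(η); η) = 0 for all η in a neighborhood of 0, and ρ(0) = i·√Ω. Then the real part of the derivative of ρ at 0 equals Ω / (2·(Ω + γ²)). -/
theorem hopf_transversality (γ Ω : ℝ) (hγ : 0 < γ) (hΩ : 0 < Ω)
    (ρ : ℝ → ℂ) (hdiff : DifferentiableAt ℝ ρ 0)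
    (hroot : ∀ᶠ η in nhds (0 : ℝ),
      (ρ η) ^ 3 + (γ - η : ℝ) * (ρ η) ^ 2 + (Ω : ℝ) * (ρ η) + (Ω * γ : ℝ) = 0)
    (hρ0 : ρ 0 = Complex.I * Real.sqrt Ω) :
    (deriv ρ 0).re = Ω / (2 * (Ω + γ ^ 2)) := by
  have hρ := hdiff.hasDerivAt
  have hcoef : HasDerivAt (fun η : ℝ => ((γ - η : ℝ) : ℂ)) ((-1 : ℝ) : ℂ) 0 :=
    ((hasDerivAt_id (0 : ℝ)).const_sub γ).ofReal_comp
  have hp := (((hρ.pow 3).add (hcoef.mul (hρ.pow 2))).add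
    (hρ.const_mul ((Ω : ℝ) : ℂ))).add_const ((Ω * γ : ℝ) : ℂ)
  have hzero := hp.unique ((hasDerivAt_const (0 : ℝ) (0 : ℂ)).congr_of_eventuallyEq hroot)
  have hs : (√Ω) ^ 2 = Ω := Real.sq_sqrt hΩ.le
  have hsq : (ρ 0) ^ 2 = -(Ω : ℂ) := by
    rw [hρ0, mul_pow, Complex.I_sq, ← Complex.ofReal_pow, hs, neg_one_mul]
  have hlin : 2 * (-(Ω : ℂ) + γ * (Complex.I * √Ω)) * deriv ρ 0 = -(Ω : ℂ) := by
    simp only [Pi.pow_apply] at hzero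
    push_cast at hzero
    norm_num [hsq] at hzero
    rw [← hρ0]
    linear_combination hzero
  have hre := congrArg Complex.re hlin
  have him := congrArg Complex.im hlin
  simp at hre him
  rw [eq_div_iff (by positivity)]
  apply mul_left_cancel₀ hΩ.ne'
  linear_combination (-Ω) * hre + γ * √Ω * him - 2 * γ ^ 2 * (deriv ρ 0).re * hs
end

section
/- Let γ > 0, Ω > 0 and η > 0 be real numbers, and define p(z) = z³ + (γ − η)·z² + Ω·z + Ω·γ over ℂ. Then there exists a complex root z of p with Re z > 0. -/
/-- A monic complex quadratic whose linear coefficient has negative real part has a root in the open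
right half-plane. -/
theorem exists_quadratic_root_re_pos (b c : ℂ) (hb : b.re < 0) :
    ∃ z : ℂ, z ^ 2 + b * z + c = 0 ∧ 0 < z.re := by
  obtain ⟨d, hd, hre⟩ : ∃ d : ℂ, d ^ 2 = b ^ 2 - 4 * c ∧ 0 ≤ d.re := by
    obtain ⟨d, hd⟩ := IsAlgClosed.exists_pow_nat_eq (b ^ 2 - 4 * c) two_pos
    rcases le_total 0 d.re with h | h
    · exact ⟨d, hd, h⟩
    · exact ⟨-d, by rw [neg_sq, hd], by simpa using h⟩
  refine ⟨(d - b) / 2, by linear_combination hd / 4, ?_⟩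
  rw [Complex.div_ofNat_re, Complex.sub_re]
  linarith

theorem unstable_root_for_positive_eta (γ Ω η : ℝ) (hγ : 0 < γ) (hΩ : 0 < Ω) (hη : 0 < η) :
    ∃ z : ℂ, z ^ 3 + (γ - η : ℝ) * z ^ 2 + (Ω : ℝ) * z + (Ω * γ : ℝ) = 0 ∧ 0 < z.re := by
  obtain ⟨x, ⟨hx₁, hx₂⟩, hx⟩ :
      ∃ x ∈ Set.Ioo (-γ) 0, x ^ 3 + (γ - η) * x ^ 2 + Ω * x + Ω * γ = 0 := by
    have hcont : ContinuousOn (fun x : ℝ ↦ x ^ 3 + (γ - η) * x ^ 2 + Ω * x + Ω * γ)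
        (Set.Icc (-γ) 0) := by fun_prop
    refine intermediate_value_Ioo (by linarith) hcont ⟨?_, ?_⟩
    · have : 0 < η * γ ^ 2 := by positivity
      linarith
    · have : 0 < Ω * γ := by positivity
      linarith
  have hb : x + γ - η < 0 := by
    have h₁ : 0 < Ω * (x + γ) := mul_pos hΩ (by linarith)
    by_contra! h
    have h₂ : 0 ≤ x ^ 2 * (x + γ - η) := by positivity
    linarith
  obtain ⟨z, hz, hre⟩ := exists_quadratic_root_re_pos
    ((x + γ - η : ℝ) : ℂ) ((Ω + x * (x + γ - η) : ℝ) : ℂ) (by simpa only [Complex.ofReal_re] using hb)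
  refine ⟨z, ?_, hre⟩
  have hxC : (x : ℂ) ^ 3 + (γ - η) * x ^ 2 + Ω * x + Ω * γ = 0 := by exact_mod_cast hx
  push_cast at hz ⊢
  linear_combination (z - x) * hz + hxC
end

section
/- Let α, β, δ, ν, r be real numbers with ν ≠ 0, let Φ, κ : ℝ → ℝ be differentiable, and define F : ℝ³ → ℝ³ by F(ω,λ,d) = ( ω·(Φ(λ) − α), λ·(κ(1−ω−r·d)/ν − (α+β+δ)), d·(r − κ(1−ω−r·d)/ν + δ) + κ(1−ω−r·d) − (1−ω) ). Let (ω₀, λ₀, d₀) satisfy Φ(λ₀) = α and κ(π₀) = ν·(α+β+δ) with π₀ = 1 − ω₀ − r·d₀. Then the total derivative (Jacobian) of F at (ω₀, λ₀, d₀) is the linear map with matrix having rows (0, K₀, 0), (−K₁, 0, −r·K₁), (K₂, 0, r·K₂ − (α+β)), where K₀ = ω₀·Φ'(λ₀), K₁ = λ₀·κ'(π₀)/ν, and K₂ = ((d₀ − ν)·κ'(π₀) + ν)/ν. -/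
theorem keen_jacobian_interior (α β δ ν r : ℝ) (hν : ν ≠ 0)
    (Φ κ : ℝ → ℝ) (hΦdiff : Differentiable ℝ Φ) (hκdiff : Differentiable ℝ κ)
    (F : (Fin 3 → ℝ) → (Fin 3 → ℝ))
    (hF : ∀ x : Fin 3 → ℝ, F x =
      ![x 0 * (Φ (x 1) - α),
        x 1 * (κ (1 - x 0 - r * x 2) / ν - (α + β + δ)),
        x 2 * (r - κ (1 - x 0 - r * x 2) / ν + δ) + κ (1 - x 0 - r * x 2) - (1 - x 0)])
    (ω₀ lam₀ d₀ π₀ : ℝ) (hπ : π₀ = 1 - ω₀ - r * d₀)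
    (hΦ : Φ lam₀ = α) (hκ : κ π₀ = ν * (α + β + δ))
    (K₀ K₁ K₂ : ℝ)
    (hK₀ : K₀ = ω₀ * deriv Φ lam₀) (hK₁ : K₁ = lam₀ * deriv κ π₀ / ν)
    (hK₂ : K₂ = ((d₀ - ν) * deriv κ π₀ + ν) / ν) :
    HasFDerivAt F
      (LinearMap.toContinuousLinearMap
        (Matrix.toLin'
          (!![0, K₀, 0; -K₁, 0, -r * K₁; K₂, 0, r * K₂ - (α + β)] :
            Matrix (Fin 3) (Fin 3) ℝ)))
      ![ω₀, lam₀, d₀] := by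
  obtain rfl : F = _ := funext hF
  have hcoord (i : Fin 3) : HasFDerivAt (fun x : Fin 3 → ℝ => x i)
      (ContinuousLinearMap.proj (R := ℝ) (φ := fun _ : Fin 3 => ℝ) i) ![ω₀, lam₀, d₀] :=
    hasFDerivAt_apply i _
  have hκ_deriv : HasDerivAt κ (deriv κ π₀) (1 - ω₀ - r * d₀) :=
    hπ ▸ (hκdiff π₀).hasDerivAt
  have hΦ_comp := HasDerivAt.comp_hasFDerivAt (h₂ := Φ) ![ω₀, lam₀, d₀]
    (hΦdiff lam₀).hasDerivAt (hcoord 1)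
  have hκ_comp := HasDerivAt.comp_hasFDerivAt (h₂ := κ) ![ω₀, lam₀, d₀]
    hκ_deriv (((hcoord 0).const_sub 1).sub ((hcoord 2).const_mul r))
  have hκ_div := hκ_comp.mul_const ν⁻¹
  rw [hπ] at hκ
  rw [hasFDerivAt_pi']
  intro i
  fin_cases i
  · refine ((hcoord 0).mul (hΦ_comp.sub_const α)).congr_fderiv ?_
    ext v
    simp [dotProduct, Fin.sum_univ_three, hΦ, hK₀, mul_assoc]
  · refine ((hcoord 1).mul (hκ_div.sub_const (α + β + δ))).congr_fderiv ?_
    ext v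
    simp [dotProduct, Fin.sum_univ_three, hκ, hK₁]
    field_simp
    ring
  · refine ((((hcoord 2).mul ((hκ_div.const_sub r).add_const δ)).add hκ_comp).sub
      ((hcoord 0).const_sub 1)).congr_fderiv ?_
    ext v
    simp [dotProduct, Fin.sum_univ_three, hκ, hK₂]
    field_simp
    ring
end

section
/- Let α, β, δ, ν, r be real numbers with ν ≠ 0, let Φ, κ : ℝ → ℝ be differentiable, and define F : ℝ³ → ℝ³ by F(ω,λ,d) = ( ω·(Φ(λ) − α), λ·(κ(1−ω−r·d)/ν − (α+β+δ)), d·(r − κ(1−ω−r·d)/ν + δ) + κ(1−ω−r·d) − (1−ω) ). Let d₁ be any real number. Then the Jacobian matrix of F at the boundary point (0, 0, d₁) has zero entries in positions (1,2), (1,3), (2,1), (2,3), and (3,2); consequently its characteristic polynomial is (X − a₁)(X − a₂)(X − a₃) where a₁ = Φ(0) − α, a₂ = κ(1 − r·d₁)/ν − (α+β+δ), and a₃ is the (3,3) entry of the Jacobian, so its eigenvalues are exactly a₁, a₂, a₃. -/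
open Polynomial

/-- A partial derivative of a differentiable map read off from its restriction to a
coordinate line. -/
theorem fderiv_single_apply_eq_of_hasDerivAt_line {ι κ : Type*} [Fintype ι] [DecidableEq ι]
    [Fintype κ] {F : (ι → ℝ) → (κ → ℝ)} {p : ι → ℝ} (hF : DifferentiableAt ℝ F p)
    {j : ι} {i : κ} {c : ℝ}
    (h : HasDerivAt (fun t : ℝ => F (p + t • Pi.single j 1) i) c 0) :
    fderiv ℝ F p (Pi.single j 1) i = c :=
  ((hasDerivAt_pi.1 (hF.hasFDerivAt.hasLineDerivAt (Pi.single j 1))) i).unique h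

/-- The characteristic polynomial of a `3 × 3` matrix with vanishing entries outside the diagonal
and the bottom-left corner. -/
theorem Matrix.charpoly_fin_three_of_offDiag_eq_zero {R : Type*} [CommRing R]
    {J : Matrix (Fin 3) (Fin 3) R}
    (h01 : J 0 1 = 0) (h02 : J 0 2 = 0) (h12 : J 1 2 = 0) :
    J.charpoly = (X - C (J 0 0)) * (X - C (J 1 1)) * (X - C (J 2 2)) := by
  simp [Matrix.charpoly, Matrix.det_fin_three, h01, h02, h12]

theorem keen_jacobian_boundary (α β δ ν r : ℝ) (hν : ν ≠ 0)
    (Φ κ : ℝ → ℝ) (hΦdiff : Differentiable ℝ Φ) (hκdiff : Differentiable ℝ κ)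
    (F : (Fin 3 → ℝ) → (Fin 3 → ℝ))
    (hF : ∀ x : Fin 3 → ℝ, F x =
      ![x 0 * (Φ (x 1) - α),
        x 1 * (κ (1 - x 0 - r * x 2) / ν - (α + β + δ)),
        x 2 * (r - κ (1 - x 0 - r * x 2) / ν + δ) + κ (1 - x 0 - r * x 2) - (1 - x 0)])
    (d₁ : ℝ) (J : Matrix (Fin 3) (Fin 3) ℝ)
    (hJ : ∀ i j : Fin 3, J i j = fderiv ℝ F ![0, 0, d₁] (Pi.single j 1) i)
    (a₁ a₂ : ℝ) (ha₁ : a₁ = Φ 0 - α) (ha₂ : a₂ = κ (1 - r * d₁) / ν - (α + β + δ)) :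
    J 0 1 = 0 ∧ J 0 2 = 0 ∧ J 1 0 = 0 ∧ J 1 2 = 0 ∧ J 2 1 = 0 ∧
      J.charpoly = (X - C a₁) * (X - C a₂) * (X - C (J 2 2)) ∧
      spectrum ℝ J = {a₁, a₂, J 2 2} := by
  have hdiff : Differentiable ℝ F := by
    rw [funext hF, differentiable_pi]
    intro i
    fin_cases i <;> simp <;> fun_prop
  have entry {i j : Fin 3} {c : ℝ}
      (h : HasDerivAt (fun t : ℝ => F (![0, 0, d₁] + t • Pi.single j 1) i) c 0) : J i j = c :=
    (hJ i j).trans (fderiv_single_apply_eq_of_hasDerivAt_line (hdiff _) h)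
  have h01 : J 0 1 = 0 := entry (by simp [hF, -Matrix.cons_add, hasDerivAt_const])
  have h02 : J 0 2 = 0 := entry (by simp [hF, -Matrix.cons_add, hasDerivAt_const])
  have h10 : J 1 0 = 0 := entry (by simp [hF, -Matrix.cons_add, hasDerivAt_const])
  have h12 : J 1 2 = 0 := entry (by simp [hF, -Matrix.cons_add, hasDerivAt_const])
  have h21 : J 2 1 = 0 := entry (by simp [hF, -Matrix.cons_add, hasDerivAt_const])
  have h00 : J 0 0 = a₁ :=
    entry (by simpa [hF, -Matrix.cons_add, ha₁] using (hasDerivAt_id (0 : ℝ)).mul_const (Φ 0 - α))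
  have h11 : J 1 1 = a₂ :=
    entry (by simpa [hF, -Matrix.cons_add, ha₂] using
      (hasDerivAt_id (0 : ℝ)).mul_const (κ (1 - r * d₁) / ν - (α + β + δ)))
  have hchar : J.charpoly = (X - C a₁) * (X - C a₂) * (X - C (J 2 2)) := by
    rw [Matrix.charpoly_fin_three_of_offDiag_eq_zero h01 h02 h12, h00, h11]
  refine ⟨h01, h02, h10, h12, h21, hchar, ?_⟩
  ext x
  rw [Matrix.mem_spectrum_iff_isRoot_charpoly, hchar]
  simp [sub_eq_zero, or_assoc]
end

section
/- Let α, β, δ, ν, κ be real numbers with ν ≠ 0, let Φ : ℝ → ℝ be continuous, and let F : ℝ → ℝ be an antiderivative of s ↦ (Φ(s) − α)/s on (0,∞). Define I : (0,∞) × (0,∞) → ℝ by I(ω, λ) = F(λ) + (α + β + δ − κ/ν)·log ω + (κ/ν)·ω. Suppose ω, λ : ℝ → ℝ are differentiable functions with ω(t) > 0 and λ(t) > 0 for all t, satisfying ω'(t) = ω(t)·(Φ(λ(t)) − α) and λ'(t) = λ(t)·(κ·(1 − ω(t))/ν − (α + β + δ)) for all t. Then the function t ↦ I(ω(t), λ(t))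 has derivative zero at every t; i.e., I is a first integral of the planar wage–employment subsystem. -/
theorem goodwin_first_integral (α β δ ν κ : ℝ) (hν : ν ≠ 0)
    (Φ : ℝ → ℝ) (hΦcont : Continuous Φ)
    (F : ℝ → ℝ) (hF : ∀ s ∈ Set.Ioi (0 : ℝ), HasDerivAt F ((Φ s - α) / s) s)
    (I : ℝ → ℝ → ℝ)
    (hI : ∀ ω lam : ℝ, I ω lam =
      F lam + (α + β + δ - κ / ν) * Real.log ω + (κ / ν) * ω)
    (ω lam : ℝ → ℝ)
    (hωpos : ∀ t, 0 < ω t) (hlampos : ∀ t, 0 < lam t)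
    (hω : ∀ t, HasDerivAt ω (ω t * (Φ (lam t) - α)) t)
    (hlam : ∀ t, HasDerivAt lam (lam t * (κ * (1 - ω t) / ν - (α + β + δ))) t) :
    ∀ t : ℝ, HasDerivAt (fun t => I (ω t) (lam t)) 0 t := by
  intro t
  have hFlam := (hF (lam t) (hlampos t)).comp t (hlam t)
  have hlog := ((hω t).log (hωpos t).ne').const_mul (α + β + δ - κ / ν)
  have hlin := (hω t).const_mul (κ / ν)
  simp only [hI]
  refine ((hFlam.add hlog).add hlin).congr_deriv ?_
  have hω0 := (hωpos t).ne'
  have hlam0 := (hlampos t).ne'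
  field_simp
  ring
end
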